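/- Let G be a finite simple graph of order n having no connected component isomorphic to a star K_{1,u} for any integer u ≥ 0 (in particular no isolated vertices). Then for every odd integer t ≥ n and every Abelian group 𝒢 of order t, there exists a 𝒢-irregular labeling of G. -/

import Mathlib

/-- The weighted degree of a vertex `v` under an edge labeling `f` with values in an
additive Abelian group: the sum of the labels of all edges incident to `v`. -/
noncomputable def SimpleGraph.wdeg {V : Type} [Fintype V] (G : SimpleGraph V)
    {A : Type} [AddCommGroup A] (f : Sym2 V → A) (v : V) : A :=
  ∑ u ∈ (G.neighborSet v).toFinite.toFinset, f s(v, u)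

/-- An edge labeling `f` with values in an Abelian group `A` is `A`-irregular if the
weighted degrees of all vertices are pairwise distinct. -/
def SimpleGraph.IsIrregular {V : Type} [Fintype V] (G : SimpleGraph V)
    {A : Type} [AddCommGroup A] (f : Sym2 V → A) : Prop :=
  Function.Injective (G.wdeg f)

/-- The group irregularity strength `s_g(G)`: the smallest integer `s` such that for
every Abelian group of order `s` there exists a `𝒢`-irregular labeling of `G`. -/
noncomputable def SimpleGraph.groupIrregularityStrength {V : Type} [Fintype V]
    (G : SimpleGraph V) : ℕ :=
  sInf {s : ℕ | ∀ (A : Type) [AddCommGroup A] [Fintype A],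
    Fintype.card A = s → ∃ f : Sym2 V → A, G.IsIrregular f}

/-- The modular edge-gracefulness `k(G)`: the smallest integer `k ≥ |V(G)|` such that
there exists a `ℤ_k`-irregular labeling of `G`. -/
noncomputable def SimpleGraph.modularEdgeGracefulness {V : Type} [Fintype V]
    (G : SimpleGraph V) : ℕ :=
  sInf {k : ℕ | Fintype.card V ≤ k ∧ ∃ f : Sym2 V → ZMod k, G.IsIrregular f}

/-- `(X, Y)` is a bipartition of the connected component `c` of `G`: the two classes
partition the vertex set of `c` and every edge of the component joins `X` and `Y`. -/
def SimpleGraph.IsComponentBipartition {V : Type} (G : SimpleGraph V)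
    (c : G.ConnectedComponent) (X Y : Set V) : Prop :=
  X ∪ Y = c.supp ∧ Disjoint X Y ∧
    ∀ u v : V, u ∈ c.supp → v ∈ c.supp → G.Adj u v →
      ((u ∈ X ∧ v ∈ Y) ∨ (u ∈ Y ∧ v ∈ X))


/-- The properties of a (hooked) Skolem sequence. -/
def SkolemProp (k : ℕ) (a : ℕ → ℕ) : Prop :=
  ∀ i j, 1 ≤ i → i ≤ k → 1 ≤ j → j ≤ k →
    1 ≤ a i ∧ a i + i ≤ 2 * k + 1 ∧ a i ≠ a j + j ∧ (a i = a j → i = j) ∧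
    (a i + i = a j + j → i = j) ∧ a i + (a j + j) ≠ 4 * k + 1 ∧ a i + a j ≠ 4 * k + 1 ∧
    (a i + i) + (a j + j) ≠ 4 * k + 1

set_option maxHeartbeats 4000000 in
theorem skolem_of (k : ℕ) (a : ℕ → ℕ) (c d : ℕ)
    (hcd : c = 2 * k + 1 ∧ d = 2 * k ∨ c = 2 * k ∧ d = 2 * k + 1)
    (h1 : ∀ i, 1 ≤ i → i ≤ k → 1 ≤ a i ∧ a i + i ≤ 2 * k + 1 ∧ a i ≠ c ∧ a i + i ≠ c)
    (h2 : ∀ i j, 1 ≤ i → i ≤ k → 1 ≤ j → j ≤ k →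
      a i ≠ a j + j ∧ (a i = a j → i = j) ∧ (a i + i = a j + j → i = j)) : SkolemProp k a := by
  intro i j hi hi' hj hj'
  have e1 := h1 i hi hi'
  have e2 := h1 j hj hj'
  obtain ⟨e3, e4, e5⟩ := h2 i j hi hi' hj hj'
  refine ⟨e1.1, e1.2.1, e3, e4, e5, ?_, ?_, ?_⟩ <;> omega

set_option maxHeartbeats 4000000 in
theorem skolem0 (s : ℕ) (hs : 2 ≤ s) : ∃ a, SkolemProp (4 * s) a := by
  let a : ℕ → ℕ := fun i =>
    if i % 2 = 0 then 6 * s - i / 2 else if i = 1 then s else if i = 2 * s - 1 then 2 * s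
    else if i = 2 * s + 1 then s - 1 else if i = 4 * s - 1 then 2 * s + 1
    else if i < 2 * s then s + 1 + (2 * s - 1 - i) / 2 else (4 * s - 1 - i) / 2
  have spec : ∀ i, 1 ≤ i → i ≤ 4 * s → ∃ r,
      (i = 2 * r ∧ 1 ≤ r ∧ r ≤ 2 * s ∧ a i + r = 6 * s) ∨ (i = 1 ∧ a i = s) ∨
      (i + 1 = 2 * s ∧ 2 ≤ i ∧ a i = 2 * s) ∨ (i = 2 * s + 1 ∧ a i + 1 = s) ∨
      (i + 1 = 4 * s ∧ a i = 2 * s + 1) ∨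
      (i = 2 * r + 1 ∧ 1 ≤ r ∧ r + 2 ≤ s ∧ a i + r = 2 * s) ∨
      (i = 2 * r + 1 ∧ s + 1 ≤ r ∧ r + 2 ≤ 2 * s ∧ a i + r + 1 = 2 * s) := by
    intro i h1 h2
    refine ⟨i / 2, ?_⟩
    simp only [a]
    split_ifs
    · exact Or.inl (by constructorm* _ ∧ _ <;> omega)
    · exact Or.inr (Or.inl (by constructorm* _ ∧ _ <;> omega))
    · exact Or.inr (Or.inr (Or.inl (by constructorm* _ ∧ _ <;> omega)))
    · exact Or.inr (Or.inr (Or.inr (Or.inl (by constructorm* _ ∧ _ <;> omega))))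
    · exact Or.inr (Or.inr (Or.inr (Or.inr (Or.inl (by constructorm* _ ∧ _ <;> omega)))))
    · exact Or.inr (Or.inr (Or.inr (Or.inr (Or.inr (Or.inl (by constructorm* _ ∧ _ <;> omega))))))
    · exact Or.inr (Or.inr (Or.inr (Or.inr (Or.inr (Or.inr ((by constructorm* _ ∧ _ <;> omega)))))))
  refine ⟨a, skolem_of _ a (2 * (4 * s) + 1) (2 * (4 * s)) (by omega) ?_ ?_⟩
  · intro i h1 h2
    obtain ⟨r, h⟩ := spec i h1 h2
    generalize a i = x at *
    clear spec a
    rcases h with h | h | h | h | h | h | h <;> refine ⟨?_, ?_, ?_, ?_⟩ <;> omega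
  · intro i j h1 h2 h3 h4
    obtain ⟨r, h⟩ := spec i h1 h2
    obtain ⟨r', h'⟩ := spec j h3 h4
    generalize a i = x at *
    generalize a j = y at *
    clear spec a
    rcases h with h | h | h | h | h | h | h <;> rcases h' with h' | h' | h' | h' | h' | h' | h' <;>
      refine ⟨?_, ?_, ?_⟩ <;> omega

set_option maxHeartbeats 4000000 in
theorem skolem1 (s : ℕ) (hs : 2 ≤ s) : ∃ a, SkolemProp (4 * s + 1) a := by
  let a : ℕ → ℕ := fun i =>
    if i % 2 = 0 then 6 * s + 2 - i / 2 else if i = 1 then s + 1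
    else if i = 2 * s - 1 then 2 * s + 2
    else if i = 4 * s + 1 then 2 * s + 1
    else if i < 2 * s then s + 2 + (2 * s - 1 - i) / 2 else (4 * s + 1 - i) / 2
  have spec : ∀ i, 1 ≤ i → i ≤ 4 * s + 1 → ∃ r,
      (i = 2 * r ∧ 1 ≤ r ∧ r ≤ 2 * s ∧ a i + r = 6 * s + 2) ∨ (i = 1 ∧ a i = s + 1) ∨
      (i + 1 = 2 * s ∧ 2 ≤ i ∧ a i = 2 * s + 2) ∨
      (i = 4 * s + 1 ∧ a i = 2 * s + 1) ∨
      (i = 2 * r + 1 ∧ 1 ≤ r ∧ r + 2 ≤ s ∧ a i + r = 2 * s + 1) ∨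
      (i = 2 * r + 1 ∧ s ≤ r ∧ r + 1 ≤ 2 * s ∧ a i + r = 2 * s) := by
    intro i h1 h2
    refine ⟨i / 2, ?_⟩
    simp only [a]
    split_ifs
    · exact Or.inl (by constructorm* _ ∧ _ <;> omega)
    · exact Or.inr (Or.inl (by constructorm* _ ∧ _ <;> omega))
    · exact Or.inr (Or.inr (Or.inl (by constructorm* _ ∧ _ <;> omega)))
    · exact Or.inr (Or.inr (Or.inr (Or.inl (by constructorm* _ ∧ _ <;> omega))))
    · exact Or.inr (Or.inr (Or.inr (Or.inr (Or.inl (by constructorm* _ ∧ _ <;> omega)))))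
    · exact Or.inr (Or.inr (Or.inr (Or.inr (Or.inr ((by constructorm* _ ∧ _ <;> omega))))))
  refine ⟨a, skolem_of _ a (2 * (4 * s + 1) + 1) (2 * (4 * s + 1)) (by omega) ?_ ?_⟩
  · intro i h1 h2
    obtain ⟨r, h⟩ := spec i h1 h2
    generalize a i = x at *
    clear spec a
    rcases h with h | h | h | h | h | h <;> refine ⟨?_, ?_, ?_, ?_⟩ <;> omega
  · intro i j h1 h2 h3 h4
    obtain ⟨r, h⟩ := spec i h1 h2
    obtain ⟨r', h'⟩ := spec j h3 h4
    generalize a i = x at *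
    generalize a j = y at *
    clear spec a
    rcases h with h | h | h | h | h | h <;> rcases h' with h' | h' | h' | h' | h' | h' <;>
      refine ⟨?_, ?_, ?_⟩ <;> omega

set_option maxHeartbeats 4000000 in
theorem skolem2 (s : ℕ) : ∃ a, SkolemProp (4 * s + 2) a := by
  let a : ℕ → ℕ := fun i =>
    if i = 4 * s + 2 then 4 * s + 3 else if i % 2 = 0 then (4 * s + 2 - i) / 2
    else if i = 4 * s + 1 then 2 * s + 1
    else if i = 1 then 7 * s + 3
    else if i = 2 * s + 1 then 4 * s + 2
    else if i < 2 * s then 5 * s + 2 + (2 * s + 1 - i) / 2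
    else 4 * s + 3 + (4 * s + 1 - i) / 2
  have spec : ∀ i, 1 ≤ i → i ≤ 4 * s + 2 → ∃ r,
      (i = 4 * s + 2 ∧ a i = 4 * s + 3) ∨
      (i = 2 * r ∧ 1 ≤ r ∧ r ≤ 2 * s ∧ a i + r = 2 * s + 1) ∨
      (i = 4 * s + 1 ∧ a i = 2 * s + 1) ∨
      (i = 1 ∧ 1 ≤ s ∧ a i = 7 * s + 3) ∨
      (i = 2 * s + 1 ∧ 1 ≤ s ∧ a i = 4 * s + 2) ∨
      (i = 2 * r + 1 ∧ 1 ≤ r ∧ r + 1 ≤ s ∧ a i + r = 6 * s + 2) ∨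
      (i = 2 * r + 1 ∧ s + 1 ≤ r ∧ r + 1 ≤ 2 * s ∧ a i + r = 6 * s + 3) := by
    intro i h1 h2
    refine ⟨i / 2, ?_⟩
    simp only [a]
    split_ifs
    · exact Or.inl (by constructorm* _ ∧ _ <;> omega)
    · exact Or.inr (Or.inl (by constructorm* _ ∧ _ <;> omega))
    · exact Or.inr (Or.inr (Or.inl (by constructorm* _ ∧ _ <;> omega)))
    · exact Or.inr (Or.inr (Or.inr (Or.inl (by constructorm* _ ∧ _ <;> omega))))
    · exact Or.inr (Or.inr (Or.inr (Or.inr (Or.inl (by constructorm* _ ∧ _ <;> omega)))))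
    · exact Or.inr (Or.inr (Or.inr (Or.inr (Or.inr (Or.inl (by constructorm* _ ∧ _ <;> omega))))))
    · exact Or.inr (Or.inr (Or.inr (Or.inr (Or.inr (Or.inr ((by constructorm* _ ∧ _ <;> omega)))))))
  refine ⟨a, skolem_of _ a (2 * (4 * s + 2)) (2 * (4 * s + 2) + 1) (by omega) ?_ ?_⟩
  · intro i h1 h2
    obtain ⟨r, h⟩ := spec i h1 h2
    generalize a i = x at *
    clear spec a
    rcases h with h | h | h | h | h | h | h <;> refine ⟨?_, ?_, ?_, ?_⟩ <;> omega
  · intro i j h1 h2 h3 h4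
    obtain ⟨r, h⟩ := spec i h1 h2
    obtain ⟨r', h'⟩ := spec j h3 h4
    generalize a i = x at *
    generalize a j = y at *
    clear spec a
    rcases h with h | h | h | h | h | h | h <;> rcases h' with h' | h' | h' | h' | h' | h' | h' <;>
      refine ⟨?_, ?_, ?_⟩ <;> omega

set_option maxHeartbeats 4000000 in
theorem skolem3 (s : ℕ) (hs : 2 ≤ s) : ∃ a, SkolemProp (4 * s - 1) a := by
  let a : ℕ → ℕ := fun i =>
    if i = 4 * s - 2 then 2 * s + 1 else if i % 2 = 0 then 6 * s - 1 - i / 2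
    else if i = 1 then s else if i = 2 * s - 1 then 2 * s
    else if i = 2 * s + 1 then s - 1 else if i = 4 * s - 1 then 4 * s
    else if i < 2 * s then s + 1 + (2 * s - 1 - i) / 2 else (4 * s - 1 - i) / 2
  have spec : ∀ i, 1 ≤ i → i ≤ 4 * s - 1 → ∃ r,
      (i + 2 = 4 * s ∧ a i = 2 * s + 1) ∨
      (i = 2 * r ∧ 1 ≤ r ∧ r + 2 ≤ 2 * s ∧ a i + r + 1 = 6 * s) ∨ (i = 1 ∧ a i = s) ∨
      (i + 1 = 2 * s ∧ 2 ≤ i ∧ a i = 2 * s) ∨ (i = 2 * s + 1 ∧ a i + 1 = s) ∨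
      (i + 1 = 4 * s ∧ a i = 4 * s) ∨
      (i = 2 * r + 1 ∧ 1 ≤ r ∧ r + 2 ≤ s ∧ a i + r = 2 * s) ∨
      (i = 2 * r + 1 ∧ s + 1 ≤ r ∧ r + 2 ≤ 2 * s ∧ a i + r + 1 = 2 * s) := by
    intro i h1 h2
    refine ⟨i / 2, ?_⟩
    simp only [a]
    split_ifs
    · exact Or.inl (by constructorm* _ ∧ _ <;> omega)
    · exact Or.inr (Or.inl (by constructorm* _ ∧ _ <;> omega))
    · exact Or.inr (Or.inr (Or.inl (by constructorm* _ ∧ _ <;> omega)))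
    · exact Or.inr (Or.inr (Or.inr (Or.inl (by constructorm* _ ∧ _ <;> omega))))
    · exact Or.inr (Or.inr (Or.inr (Or.inr (Or.inl (by constructorm* _ ∧ _ <;> omega)))))
    · exact Or.inr (Or.inr (Or.inr (Or.inr (Or.inr (Or.inl (by constructorm* _ ∧ _ <;> omega))))))
    · exact Or.inr (Or.inr (Or.inr (Or.inr (Or.inr (Or.inr (Or.inl (by constructorm* _ ∧ _ <;> omega)))))))
    · exact Or.inr (Or.inr (Or.inr (Or.inr (Or.inr (Or.inr (Or.inr ((by constructorm* _ ∧ _ <;> omega))))))))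
  refine ⟨a, skolem_of _ a (2 * (4 * s - 1)) (2 * (4 * s - 1) + 1) (by omega) ?_ ?_⟩
  · intro i h1 h2
    obtain ⟨r, h⟩ := spec i h1 h2
    generalize a i = x at *
    clear spec a
    rcases h with h | h | h | h | h | h | h | h <;> refine ⟨?_, ?_, ?_, ?_⟩ <;> omega
  · intro i j h1 h2 h3 h4
    obtain ⟨r, h⟩ := spec i h1 h2
    obtain ⟨r', h'⟩ := spec j h3 h4
    generalize a i = x at *
    generalize a j = y at *
    clear spec a
    rcases h with h | h | h | h | h | h | h | h <;> rcases h' with h' | h' | h' | h' | h' | h' | h' | h' <;>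
      refine ⟨?_, ?_, ?_⟩ <;> omega

set_option maxHeartbeats 4000000 in
theorem skolem_exists (k : ℕ) : ∃ a, SkolemProp k a := by
  by_cases hk : 6 ≤ k
  · have h : k % 4 = 0 ∨ k % 4 = 1 ∨ k % 4 = 2 ∨ k % 4 = 3 := by omega
    rcases h with h | h | h | h
    · obtain ⟨s, rfl⟩ : ∃ s, k = 4 * s := ⟨k / 4, by omega⟩
      exact skolem0 s (by omega)
    · obtain ⟨s, rfl⟩ : ∃ s, k = 4 * s + 1 := ⟨k / 4, by omega⟩
      exact skolem1 s (by omega)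
    · obtain ⟨s, rfl⟩ : ∃ s, k = 4 * s + 2 := ⟨k / 4, by omega⟩
      exact skolem2 s
    · obtain ⟨s, rfl⟩ : ∃ s, k = 4 * s - 1 := ⟨k / 4 + 1, by omega⟩
      exact skolem3 s (by omega)
  · have h : k = 0 ∨ k = 1 ∨ k = 2 ∨ k = 3 ∨ k = 4 ∨ k = 5 := by omega
    rcases h with rfl | rfl | rfl | rfl | rfl | rfl
    · exact ⟨fun _ => 0, fun i j h1 h2 => (by omega : False).elim⟩
    · refine ⟨fun _ => 1, fun i j h1 h2 h3 h4 => by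
        dsimp only; omega⟩
    · exact skolem2 0
    · refine ⟨fun i => if i = 1 then 2 else if i = 2 then 5 else 1, fun i j h1 h2 h3 h4 => ?_⟩
      interval_cases i <;> interval_cases j <;> decide
    · refine ⟨fun i => if i = 1 then 1 else if i = 2 then 4 else if i = 3 then 5 else 3,
        fun i j h1 h2 h3 h4 => ?_⟩
      interval_cases i <;> interval_cases j <;> decide
    · refine ⟨fun i => if i = 1 then 8 else if i = 2 then 1 else if i = 3 then 4 else
        if i = 4 then 2 else 5, fun i j h1 h2 h3 h4 => ?_⟩
      interval_cases i <;> interval_cases j <;> decide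


/-- A system of zero-sum triples which, with their negatives, are pairwise disjoint. -/
def SixSys {ι A : Type} [AddCommGroup A] (g : ι → Fin 3 → A) : Prop :=
  (∀ i, g i 0 + g i 1 + g i 2 = 0) ∧ (∀ i j i' j', g i j = g i' j' → i = i' ∧ j = j') ∧
    ∀ i j i' j', g i j ≠ - g i' j'

theorem SixSys.map {ι A B : Type} [AddCommGroup A] [AddCommGroup B] {g : ι → Fin 3 → A}
    (hg : SixSys g) (φ : A →+ B) (hφ : Function.Injective φ) :
    SixSys (fun i j => φ (g i j)) := by
  refine ⟨fun i => ?_, fun i j i' j' h => hg.2.1 _ _ _ _ (hφ h), fun i j i' j' h => ?_⟩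
  · rw [← map_add, ← map_add, hg.1, map_zero]
  · rw [← map_neg] at h
    exact hg.2.2 _ _ _ _ (hφ h)

theorem SixSys.toFin {ι A : Type} [AddCommGroup A] [Fintype ι] {g : ι → Fin 3 → A}
    (hg : SixSys g) (k : ℕ) (hk : k ≤ Fintype.card ι) :
    ∃ g' : Fin k → Fin 3 → A, SixSys g' := by
  obtain ⟨e⟩ := Function.Embedding.nonempty_of_card_le (α := Fin k) (β := ι) (by simpa using hk)
  refine ⟨fun i => g (e i), fun i => hg.1 _, fun i j i' j' h => ?_, fun i j i' j' => hg.2.2 _ _ _ _⟩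
  obtain ⟨h1, h2⟩ := hg.2.1 _ _ _ _ h
  exact ⟨e.injective h1, h2⟩

theorem zmod_cast_eq (t x y : ℕ) (hx : x < t) (hy : y < t) (h : (x : ZMod t) = y) : x = y := by
  rw [ZMod.natCast_eq_natCast_iff] at h
  rwa [Nat.ModEq, Nat.mod_eq_of_lt hx, Nat.mod_eq_of_lt hy] at h

theorem zmod_cast_neg (t x y : ℕ) (hx : 0 < x) (hxy : x + y < 2 * t)
    (h : (x : ZMod t) = -y) : x + y = t := by
  have h2 : ((x + y : ℕ) : ZMod t) = 0 := by push_cast; rw [h]; ring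
  rw [ZMod.natCast_eq_zero_iff] at h2
  obtain ⟨c, hc⟩ := h2
  rcases c with _ | _ | c
  · omega
  · omega
  · nlinarith

theorem sixsys_zmod (t k : ℕ) (ht : Odd t) (hk : 6 * k + 1 ≤ t) :
    ∃ g : Fin k → Fin 3 → ZMod t, SixSys g := by
  obtain ⟨a, ha⟩ := skolem_exists k
  obtain ⟨m, hm⟩ := ht
  refine ⟨fun i => ![((i.1 + 1 : ℕ) : ZMod t), ((k + a (i.1 + 1) : ℕ) : ZMod t),
    -((k + (a (i.1 + 1) + (i.1 + 1)) : ℕ) : ZMod t)], ?_, ?_, ?_⟩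
  · intro i
    simp
    ring
  · rintro ⟨i, hi⟩ j ⟨i', hi'⟩ j' h
    have h1 := ha (i + 1) (i' + 1) (by omega) (by omega) (by omega) (by omega)
    have h2 := ha (i' + 1) (i + 1) (by omega) (by omega) (by omega) (by omega)
    fin_cases j <;> fin_cases j' <;> simp [-Nat.cast_add, -Nat.cast_one] at h ⊢
    · have := zmod_cast_eq _ _ _ (by omega) (by omega) h; omega
    · have := zmod_cast_eq _ _ _ (by omega) (by omega) h; omega
    · have := zmod_cast_neg _ _ _ (by omega) (by omega) h; omega
    · have := zmod_cast_eq _ _ _ (by omega) (by omega) h; omega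
    · have := zmod_cast_eq _ _ _ (by omega) (by omega) h; omega
    · have := zmod_cast_neg _ _ _ (by omega) (by omega) h; omega
    · have := zmod_cast_neg _ _ _ (by omega) (by omega) h.symm; omega
    · have := zmod_cast_neg _ _ _ (by omega) (by omega) h.symm; omega
    · have := zmod_cast_eq _ _ _ (by omega) (by omega) h; omega
  · rintro ⟨i, hi⟩ j ⟨i', hi'⟩ j' h
    have h1 := ha (i + 1) (i' + 1) (by omega) (by omega) (by omega) (by omega)
    have h2 := ha (i' + 1) (i + 1) (by omega) (by omega) (by omega) (by omega)
    fin_cases j <;> fin_cases j' <;> simp [-Nat.cast_add, -Nat.cast_one] at h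
    · have := zmod_cast_neg _ _ _ (by omega) (by omega) h; omega
    · have := zmod_cast_neg _ _ _ (by omega) (by omega) h; omega
    · have := zmod_cast_eq _ _ _ (by omega) (by omega) h; omega
    · have := zmod_cast_neg _ _ _ (by omega) (by omega) h; omega
    · have := zmod_cast_neg _ _ _ (by omega) (by omega) h; omega
    · have := zmod_cast_eq _ _ _ (by omega) (by omega) h; omega
    · have := zmod_cast_eq _ _ _ (by omega) (by omega) h; omega
    · have := zmod_cast_eq _ _ _ (by omega) (by omega) h; omega
    · have := zmod_cast_neg _ _ _ (by omega) (by omega) h.symm; omega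

theorem odd_two_inj {A : Type} [AddCommGroup A] [Fintype A] (hA : Odd (Fintype.card A)) (x : A)
    (h : x + x = 0) : x = 0 := by
  have h1 : addOrderOf x ∣ 2 := addOrderOf_dvd_of_nsmul_eq_zero (by rw [two_nsmul, h])
  have h2 : addOrderOf x ∣ Fintype.card A := addOrderOf_dvd_card
  have h3 := Nat.dvd_gcd h1 h2
  rw [(Nat.coprime_two_left.2 hA : Nat.gcd 2 _ = 1)] at h3
  exact AddMonoid.addOrderOf_eq_one_iff.1 (Nat.dvd_one.1 h3)

theorem three_inj {A : Type} [AddCommGroup A] [Fintype A] (hA : ¬ 3 ∣ Fintype.card A) (x : A)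
    (h : x + x + x = 0) : x = 0 := by
  have h1 : addOrderOf x ∣ 3 := addOrderOf_dvd_of_nsmul_eq_zero (by rw [succ_nsmul, two_nsmul, h])
  have h2 : addOrderOf x ∣ Fintype.card A := addOrderOf_dvd_card
  have h3 := Nat.dvd_gcd h1 h2
  rw [((Nat.Prime.coprime_iff_not_dvd Nat.prime_three).2 hA : Nat.gcd 3 _ = 1)] at h3
  exact AddMonoid.addOrderOf_eq_one_iff.1 (Nat.dvd_one.1 h3)

/-- Choosing representatives modulo sign. -/
theorem half_exists {H : Type} [AddCommGroup H] [Fintype H] (hH : Odd (Fintype.card H)) :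
    ∃ P : Finset H, (∀ x ∈ P, ∀ y ∈ P, x ≠ -y) ∧ Fintype.card H ≤ 2 * P.card + 1 := by
  classical
  obtain ⟨e⟩ : Nonempty (H ≃ Fin (Fintype.card H)) := ⟨Fintype.equivFin H⟩
  let P : Finset H := Finset.univ.filter fun x => e x < e (-x)
  refine ⟨P, ?_, ?_⟩
  · intro x hx y hy h
    simp only [P, Finset.mem_filter, Finset.mem_univ, true_and] at hx hy
    subst h
    rw [neg_neg] at hx
    exact lt_asymm hx hy
  · have : (Finset.univ : Finset H) ⊆ (P ∪ P.image (fun x => -x)) ∪ {0} := by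
      intro x _
      simp only [P, Finset.mem_union, Finset.mem_filter, Finset.mem_univ, true_and,
        Finset.mem_image, Finset.mem_singleton]
      rcases lt_trichotomy (e x) (e (-x)) with h | h | h
      · exact Or.inl (Or.inl h)
      · right
        have := e.injective h
        exact odd_two_inj hH x (by nth_rewrite 1 [this]; simp)
      · exact Or.inl (Or.inr ⟨-x, by simpa using h, by simp⟩)
    have h1 := Finset.card_le_card this
    have h2 := Finset.card_union_le (P ∪ P.image (fun x => -x)) {0}
    have h3 := Finset.card_union_le P (P.image (fun x => -x))
    have h4 := Finset.card_image_le (s := P) (f := fun x => -x)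
    simp only [Finset.card_univ, Finset.card_singleton] at *
    omega

/-- Case of a subgroup of index three. -/
theorem sixsys_three {A : Type} [AddCommGroup A] [Fintype A] (hA : Odd (Fintype.card A))
    (φ : A →+ ZMod 3) (hφ : Function.Surjective φ) (k : ℕ) (hk : 6 * k + 1 ≤ Fintype.card A) :
    ∃ g : Fin k → Fin 3 → A, SixSys g := by
  classical
  have hcard : Nat.card A = Nat.card (ZMod 3) * Nat.card φ.ker := by
    rw [AddSubgroup.card_eq_card_quotient_mul_card_addSubgroup φ.ker,
      Nat.card_congr (QuotientAddGroup.quotientKerEquivOfSurjective φ hφ).toEquiv]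
  rw [Nat.card_zmod, Nat.card_eq_fintype_card, Nat.card_eq_fintype_card] at hcard
  have hH : Odd (Fintype.card φ.ker) := by
    rw [hcard] at hA
    exact (Nat.odd_mul.1 hA).2
  obtain ⟨P, hP, hPc⟩ := half_exists hH
  obtain ⟨a, ha⟩ := hφ 1
  have key : SixSys (ι := P) (fun h => ![a + (h.1 : A), -a + (h.1 : A), -((h.1 : A) + (h.1 : A))]) := by
    have hker : ∀ h : φ.ker, φ (h : A) = 0 := fun h => h.2
    have d1 : (1 : ZMod 3) ≠ -1 := by decide
    have d2 : (-1 : ZMod 3) ≠ 1 := by decide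
    have dd : ∀ x y : φ.ker, (x : A) + x = y + y → x = y := by
      intro x y h
      have h' : x + x = y + y := Subtype.ext h
      have := odd_two_inj hH (x - y) (by rw [sub_add_sub_comm, h', sub_self])
      exact sub_eq_zero.1 this
    have nn : ∀ x ∈ P, ∀ y ∈ P, (x : A) ≠ -(y : A) := by
      intro x hx y hy h
      exact hP x hx y hy (Subtype.ext h)
    refine ⟨?_, ?_, ?_⟩
    · intro h
      simp
      abel
    · rintro ⟨x, hx⟩ j ⟨y, hy⟩ j' h
      have h1 := congrArg φ h
      have hh := dd x y
      fin_cases j <;> fin_cases j' <;>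
        simp [hker, ha, d1, d2] at h h1 ⊢
      · exact h
      · exact h
      · apply hh; rw [← neg_inj, neg_add, neg_add, h]
    · rintro ⟨x, hx⟩ j ⟨y, hy⟩ j' h
      have h1 := congrArg φ h
      have hh := dd x (-y)
      have hn := hP x hx y hy
      have hn' := nn x hx y hy
      fin_cases j <;> fin_cases j' <;>
        simp [hker, ha, d1, d2] at h h1
      · exact hn' (by rw [← add_right_inj a, h]; abel)
      · exact hn' (by rw [← add_right_inj (-a), h]; abel)
      · apply hn; apply hh; rw [AddSubgroup.coe_neg, ← neg_add, ← h]; abel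
  refine key.toFin k ?_
  rw [Fintype.card_coe]
  omega


/-- Systems obtained from the orbits of an automorphism of order three. -/
theorem sixsys_omega {Q : Type} [AddCommGroup Q] [Fintype Q] (h2 : Odd (Fintype.card Q))
    (h3 : ¬ 3 ∣ Fintype.card Q) (w : Q →+ Q) (hw : ∀ x, x + w x + w (w x) = 0) (k : ℕ)
    (hk : 6 * k + 1 ≤ Fintype.card Q) : ∃ g : Fin k → Fin 3 → Q, SixSys g := by
  classical
  have hw' : ∀ x, w (w x) = -x - w x := fun x => by
    rw [eq_sub_iff_add_eq, eq_neg_iff_add_eq_zero, ← hw x]; abel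
  have d2 := fun x : Q => odd_two_inj h2 x
  have d3 := fun x : Q => three_inj h3 x
  have hww : ∀ x, w (w (w x)) = x := fun x => by
    rw [hw' (w x), hw']; abel
  have hwi : ∀ x y, w x = w y → x = y := fun x y h => by
    rw [← hww x, h, hww]
  have main : ∀ k : ℕ, 6 * k + 1 ≤ Fintype.card Q → ∃ s : Finset Q, s.card = k ∧
      (∀ x ∈ s, x ≠ 0) ∧ ∀ x ∈ s, ∀ y ∈ s, x ≠ y →
        (x ≠ w y ∧ x ≠ -y ∧ x ≠ - w y ∧ x ≠ w (w y) ∧ x ≠ - w (w y)) := by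
    intro k
    induction k with
    | zero => intro _; exact ⟨∅, by simp⟩
    | succ k ih =>
      intro hk
      obtain ⟨s, hs, hs0, hs1⟩ := ih (by omega)
      let T : Finset Q := (s.biUnion fun y => {y, w y, w (w y), -y, - w y, - w (w y)}) ∪ {0}
      have hT : T.card ≤ 6 * k + 1 := by
        refine (Finset.card_union_le _ _).trans ?_
        rw [Finset.card_singleton]
        have := Finset.card_biUnion_le_card_mul s
          (fun y => ({y, w y, w (w y), -y, - w y, - w (w y)} : Finset Q)) 6
          (fun y _ => Finset.card_le_six)
        omega
      obtain ⟨x, hx⟩ : ∃ x, x ∉ T := by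
        by_contra hcon
        push Not at hcon
        have : T = Finset.univ := by ext; simp [hcon]
        rw [this, Finset.card_univ] at hT
        omega
      simp only [T, Finset.mem_union, Finset.mem_biUnion, Finset.mem_insert,
        Finset.mem_singleton, not_or, not_exists, not_and] at hx
      obtain ⟨hx1, hx0⟩ := hx
      have hxs : x ∉ s := fun h => (hx1 x h).1 rfl
      refine ⟨insert x s, by rw [Finset.card_insert_of_notMem hxs, hs], ?_, ?_⟩
      · intro y hy
        rcases Finset.mem_insert.1 hy with rfl | hy
        · exact hx0
        · exact hs0 y hy
      · intro a ha b hb hab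
        rcases Finset.mem_insert.1 ha with ha' | ha' <;> rcases Finset.mem_insert.1 hb with hb' | hb'
        · exact absurd (ha'.trans hb'.symm) hab
        · subst ha'
          obtain ⟨e1, e2, e3, e4, e5, e6⟩ := hx1 b hb'
          exact ⟨e2, e4, e5, e3, e6⟩
        · subst hb'
          obtain ⟨e1, e2, e3, e4, e5, e6⟩ := hx1 a ha'
          refine ⟨?_, ?_, ?_, ?_, ?_⟩ <;> rintro rfl
          · exact e3 (hww b).symm
          · exact e4 (by simp)
          · exact e6 (by simp [hww])
          · exact e2 (hww b).symm
          · exact e5 (by simp [hww])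
        · exact hs1 a ha' b hb' hab
  obtain ⟨s, hs, hs0, hs1⟩ := main k hk
  have key : SixSys (ι := s) (fun x => ![x.1, w x.1, w (w x.1)]) := by
    have z1 : ∀ x, x = w x → x = 0 := fun x h => by
      have := hw x; rw [← h, ← h] at this; exact d3 x this
    have z2 : ∀ x, x = - w x → x = 0 := fun x h => by
      have h5 := hw x
      have h4 : x + w x = 0 := by nth_rewrite 1 [h]; simp
      rw [h4, zero_add] at h5
      have := hww x
      rw [h5, map_zero] at this
      exact this.symm
    have z3 : ∀ x : Q, x = - x → x = 0 := fun x h => d2 x (by nth_rewrite 1 [h]; simp)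
    have z4 : ∀ x, x = w (w x) → x = 0 := fun x h => by
      apply z1; nth_rewrite 2 [h]; exact (hww x).symm
    have z5 : ∀ x, x = - w (w x) → x = 0 := fun x h => by
      apply z2; nth_rewrite 2 [h]; rw [map_neg, hww, neg_neg]
    refine ⟨fun x => by simpa using hw x.1, ?_, ?_⟩
    · rintro ⟨x, hx⟩ j ⟨y, hy⟩ j' h
      have h0 := hs0 x hx
      have h0' := hs0 y hy
      by_cases hxy : x = y
      · subst hxy
        fin_cases j <;> fin_cases j' <;> simp at h ⊢
        · exact h0 (z1 _ h)
        · exact h0 (z4 _ h)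
        · exact h0 (z1 _ h.symm)
        · exact h0 (z1 _ (hwi _ _ h))
        · exact h0 (z4 _ h.symm)
        · exact h0 (z1 _ (hwi _ _ h.symm))
      · exfalso
        have e := hs1 x hx y hy hxy
        have e' := hs1 y hy x hx (Ne.symm hxy)
        fin_cases j <;> fin_cases j' <;> simp at h
        · exact hxy h
        · exact e.1 h
        · exact e.2.2.2.1 h
        · exact e'.1 h.symm
        · exact hxy (hwi _ _ h)
        · exact e.1 (hwi _ _ h)
        · exact e'.2.2.2.1 h.symm
        · exact e'.1 (hwi _ _ h.symm)
        · exact hxy (hwi _ _ (hwi _ _ h))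
    · rintro ⟨x, hx⟩ j ⟨y, hy⟩ j' h
      have h0 := hs0 x hx
      have h0' := hs0 y hy
      by_cases hxy : x = y
      · subst hxy
        fin_cases j <;> fin_cases j' <;> simp at h
        · exact h0 (z3 _ h)
        · exact h0 (z2 _ h)
        · exact h0 (z5 _ h)
        · exact h0 (z2 _ (by rw [h, neg_neg]))
        · exact h0 (z3 _ (hwi _ _ (by rw [map_neg]; exact h)))
        · exact h0 (z2 _ (hwi _ _ (by rw [map_neg]; exact h)))
        · exact h0 (z5 _ (by rw [h, neg_neg]))
        · exact h0 (z2 _ (hwi _ _ (by rw [map_neg, h, neg_neg])))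
        · exact h0 (z3 _ (hwi _ _ (hwi _ _ (by rw [map_neg, map_neg]; exact h))))
      · have e := hs1 x hx y hy hxy
        have e' := hs1 y hy x hx (Ne.symm hxy)
        fin_cases j <;> fin_cases j' <;> simp at h
        · exact e.2.1 h
        · exact e.2.2.1 h
        · exact e.2.2.2.2 h
        · exact e'.2.2.1 (by rw [h, neg_neg])
        · exact e.2.1 (hwi _ _ (by rw [map_neg]; exact h))
        · exact e.2.2.1 (hwi _ _ (by rw [map_neg]; exact h))
        · exact e'.2.2.2.2 (by rw [h, neg_neg])
        · exact e'.2.2.1 (hwi _ _ (by rw [map_neg, h, neg_neg]))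
        · exact e.2.1 (hwi _ _ (hwi _ _ (by rw [map_neg, map_neg]; exact h)))
  exact key.toFin k (by rw [Fintype.card_coe, hs])

/-- Lifting a system from a quotient. -/
theorem sixsys_lift {A Q : Type} [AddCommGroup A] [Fintype A] [AddCommGroup Q]
    (hA : Odd (Fintype.card A)) (φ : A →+ Q) (hφ : Function.Surjective φ)
    (m l : ℕ) (g : Fin m → Fin 3 → Q) (hg : SixSys g) (g' : Fin l → Fin 3 → φ.ker)
    (hg' : SixSys g') (k : ℕ) (hk : k ≤ m * Nat.card φ.ker + l) :
    ∃ g : Fin k → Fin 3 → A, SixSys g := by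
  classical
  obtain ⟨σ, hσ⟩ := hφ.hasRightInverse
  have hker : ∀ h : φ.ker, φ (h : A) = 0 := fun h => h.2
  have hg0 : ∀ i j, g i j ≠ 0 := fun i j h => hg.2.2 i j i j (by rw [h, neg_zero])
  let G : (Fin m × φ.ker) ⊕ Fin l → Fin 3 → A := fun x => match x with
    | Sum.inl (i, h) => ![σ (g i 0) + h, σ (g i 1) + h, -(σ (g i 0) + h) - (σ (g i 1) + h)]
    | Sum.inr i => fun j => (g' i j : A)
  have hG1 : ∀ i h j, φ (G (Sum.inl (i, h)) j) = g i j := by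
    intro i h j
    fin_cases j
    · simp [G, hker, hσ _]
    · simp [G, hker, hσ _]
    · have := hg.1 i
      simp only [Fin.reduceFinMk, G, Matrix.cons_val, map_sub, map_neg, map_add, hker, hσ _, add_zero]
      rw [← sub_eq_zero, ← neg_eq_zero, ← this]; abel
  have hG2 : ∀ i j, φ (G (Sum.inr i) j) = 0 := fun i j => hker _
  have key : SixSys G := by
    refine ⟨?_, ?_, ?_⟩
    · rintro (⟨i, h⟩ | i)
      · simp [G]
      · have := congrArg (fun x : φ.ker => (x : A)) (hg'.1 i)
        simpa [G] using this
    · rintro (⟨i, h⟩ | i) j (⟨i', h'⟩ | i') j' he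
      · have h1 := congrArg φ he
        rw [hG1, hG1] at h1
        obtain ⟨rfl, rfl⟩ := hg.2.1 _ _ _ _ h1
        refine ⟨?_, rfl⟩
        have : h = h' := by
          fin_cases j
          · simpa [G] using he
          · simpa [G] using he
          · have he' : ((h : A) - h') + (h - h') = 0 := by
              simp [G] at he
              have he2 := sub_eq_zero.2 he
              rw [← neg_eq_zero, ← he2]; abel
            have := odd_two_inj hA _ he'
            exact Subtype.ext (sub_eq_zero.1 this)
        rw [this]
      · have h1 := congrArg φ he
        rw [hG1, hG2] at h1
        exact absurd h1 (hg0 _ _)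
      · have h1 := congrArg φ he
        rw [hG1, hG2] at h1
        exact absurd h1.symm (hg0 _ _)
      · obtain ⟨h1, h2⟩ := hg'.2.1 i j i' j' (Subtype.ext he)
        exact ⟨by rw [h1], h2⟩
    · rintro (⟨i, h⟩ | i) j (⟨i', h'⟩ | i') j' he
      · have h1 := congrArg φ he
        rw [map_neg, hG1, hG1] at h1
        exact hg.2.2 _ _ _ _ h1
      · have h1 := congrArg φ he
        rw [map_neg, hG1, hG2, neg_zero] at h1
        exact hg0 _ _ h1
      · have h1 := congrArg φ he
        rw [map_neg, hG1, hG2] at h1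
        exact hg0 _ _ (neg_eq_zero.1 h1.symm)
      · exact hg'.2.2 i j i' j' (Subtype.ext he)
  refine key.toFin k ?_
  rw [Fintype.card_sum, Fintype.card_prod, Fintype.card_fin, Fintype.card_fin,
    ← Nat.card_eq_fintype_card]
  exact hk

theorem sixsys_prod (p k : ℕ) [NeZero p] (h2 : Odd p) (h3 : ¬ 3 ∣ p) (hk : 6 * k + 1 ≤ p * p) :
    ∃ g : Fin k → Fin 3 → (ZMod p × ZMod p), SixSys g := by
  let w : (ZMod p × ZMod p) →+ (ZMod p × ZMod p) :=
    { toFun := fun x => (-x.2, x.1 - x.2)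
      map_zero' := by simp
      map_add' := fun x y => by ext <;> simp <;> ring }
  refine sixsys_omega (by simp [ZMod.card, h2])
    (by simp [ZMod.card, Nat.Prime.dvd_mul Nat.prime_three, h3]) w ?_ k (by simpa [ZMod.card] using hk)
  intro x
  ext <;> simp [w] <;> ring

theorem sixsys_exists (N : ℕ) : ∀ (A : Type) [AddCommGroup A] [Fintype A], Fintype.card A = N →
    Odd N → ∀ k, 6 * k + 1 ≤ N → ∃ g : Fin k → Fin 3 → A, SixSys g := by
  classical
  induction N using Nat.strong_induction_on with
  | _ N ih =>
  intro A _ _ hN hodd k hk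
  obtain ⟨ι, _, n, hn, ⟨e0⟩⟩ := AddCommGroup.equiv_directSum_zmod_of_finite' A
  let e : A ≃+ (∀ i, ZMod (n i)) := e0.trans (DirectSum.addEquivProd _)
  have : ∀ i, NeZero (n i) := fun i => ⟨by have := hn i; omega⟩
  have hcard : N = ∏ i, n i := by
    rw [← hN, Fintype.card_congr e.toEquiv, Fintype.card_pi]
    simp [ZMod.card]
  by_cases h3 : 3 ∣ N
  · rw [hcard, Prime.dvd_finsetProd_iff (Nat.prime_iff.1 Nat.prime_three)] at h3
    obtain ⟨i, _, hi⟩ := h3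
    refine sixsys_three (hN ▸ hodd) (((ZMod.castHom hi (ZMod 3)).toAddMonoidHom.comp
      (Pi.evalAddMonoidHom _ i)).comp e.toAddMonoidHom) ?_ k (hN ▸ hk)
    intro x
    obtain ⟨y, hy⟩ := ZMod.castHom_surjective hi x
    refine ⟨e.symm (Pi.single i y), ?_⟩
    simpa using hy
  by_cases hco : Pairwise (Function.onFun Nat.Coprime n)
  · obtain ⟨g, hg⟩ := sixsys_zmod N k hodd hk
    subst hcard
    let e2 := (ZMod.prodEquivPi n hco).toAddEquiv.trans e.symm
    exact ⟨_, hg.map e2.toAddMonoidHom e2.injective⟩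
  · simp only [Pairwise, Function.onFun, not_forall] at hco
    obtain ⟨i, j, hij, hnc⟩ := hco
    obtain ⟨p, hp, hpi, hpj⟩ := Nat.Prime.not_coprime_iff_dvd.1 hnc
    have : NeZero p := ⟨hp.ne_zero⟩
    let φ : A →+ ZMod p × ZMod p :=
      (AddMonoidHom.prod ((ZMod.castHom hpi (ZMod p)).toAddMonoidHom.comp
        (Pi.evalAddMonoidHom _ i)) ((ZMod.castHom hpj (ZMod p)).toAddMonoidHom.comp
        (Pi.evalAddMonoidHom _ j))).comp e.toAddMonoidHom
    have hφ : Function.Surjective φ := by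
      rintro ⟨x, y⟩
      obtain ⟨x', hx⟩ := ZMod.castHom_surjective hpi x
      obtain ⟨y', hy⟩ := ZMod.castHom_surjective hpj y
      refine ⟨e.symm (Pi.single i x' + Pi.single j y'), ?_⟩
      simp at hx hy
      simp [φ, hij, hij.symm, hx, hy]
    have hc : N = p * p * Fintype.card φ.ker := by
      rw [← hN, ← Nat.card_eq_fintype_card, ← Nat.card_eq_fintype_card,
        AddSubgroup.card_eq_card_quotient_mul_card_addSubgroup φ.ker,
        Nat.card_congr (QuotientAddGroup.quotientKerEquivOfSurjective φ hφ).toEquiv, Nat.card_prod,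
        Nat.card_zmod]
    have hpN : p ∣ N := ⟨p * Fintype.card φ.ker, by rw [hc]; ring⟩
    have hp3 : ¬ 3 ∣ p := fun h => h3 (h.trans hpN)
    have hpo : Odd p := hodd.of_dvd_nat hpN
    have hHo : Odd (Fintype.card φ.ker) := hodd.of_dvd_nat ⟨p * p, by rw [hc]; ring⟩
    have hmod : p * p % 6 = 1 := by
      have h1 : p % 6 = 1 ∨ p % 6 = 5 := by
        obtain ⟨r, hr⟩ := hpo
        omega
      rcases h1 with h1 | h1 <;> rw [Nat.mul_mod, h1]
    obtain ⟨m, hm⟩ : ∃ m, p * p = 6 * m + 1 := ⟨p * p / 6, by omega⟩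
    have hHpos : 0 < Fintype.card φ.ker := hHo.pos
    obtain ⟨l, hl⟩ : ∃ l, l = (Fintype.card φ.ker - 1) / 6 := ⟨_, rfl⟩
    obtain ⟨g, hg⟩ := sixsys_prod p m hpo hp3 (by omega)
    have hlt : Fintype.card φ.ker < N := by
      rw [hc]
      have := hp.two_le
      nlinarith
    obtain ⟨g', hg'⟩ := ih _ hlt φ.ker rfl hHo l (by omega)
    refine sixsys_lift (hN ▸ hodd) φ hφ m l g hg g' hg' k ?_
    rw [Nat.card_eq_fintype_card]
    rw [hc, hm] at hk
    have : (6 * m + 1) * Fintype.card φ.ker = 6 * (m * Fintype.card φ.ker) + Fintype.card φ.ker := by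
      ring
    omega


section Partition

open scoped Classical in
/-- `w` maps `D` injectively into `R`, with zero sum on each block. -/
def GoodLab {V ι A : Type} [AddCommGroup A] (b : V → ι) (D : Finset V) (R : Finset A)
    (w : V → A) : Prop :=
  (∀ v ∈ D, w v ∈ R) ∧ Set.InjOn w D ∧ ∀ i, ∑ v ∈ D with b v = i, w v = 0

open scoped Classical in
theorem GoodLab.glue {V ι A : Type} [AddCommGroup A] {b : V → ι} {D E : Finset V} {R F : Finset A}
    {e w : V → A} (hE : E ⊆ D) (hF : F ⊆ R) (h1 : GoodLab b E F e)
    (h2 : GoodLab b (D \ E) (R \ F) w) :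
    GoodLab b D R (fun v => if v ∈ E then e v else w v) := by
  have key : ∀ v ∈ D, v ∉ E → w v ∈ R ∧ w v ∉ F := fun v hv hvE =>
    Finset.mem_sdiff.1 (h2.1 v (Finset.mem_sdiff.2 ⟨hv, hvE⟩))
  refine ⟨?_, ?_, ?_⟩
  · intro v hv
    dsimp only
    split_ifs with h
    · exact hF (h1.1 v h)
    · exact (key v hv h).1
  · intro u hu v hv huv
    dsimp only at huv
    split_ifs at huv with hu' hv' hv'
    · exact h1.2.1 hu' hv' huv
    · exact absurd (huv ▸ h1.1 u hu') (key v hv hv').2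
    · exact absurd (huv ▸ h1.1 v hv') (key u hu hu').2
    · exact h2.2.1 (Finset.mem_coe.2 (Finset.mem_sdiff.2 ⟨hu, hu'⟩))
        (Finset.mem_coe.2 (Finset.mem_sdiff.2 ⟨hv, hv'⟩)) huv
  · intro i
    have s2 := h2.2.2 i
    have s1 := h1.2.2 i
    rw [Finset.sum_filter] at s1 s2
    rw [Finset.sum_filter, ← Finset.sum_sdiff hE]
    refine (congrArg₂ (· + ·) (Finset.sum_congr rfl fun v hv => ?_)
      (Finset.sum_congr rfl fun v hv => ?_)).trans
      ((congrArg₂ (· + ·) s2 s1).trans (add_zero 0))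
    · rw [if_neg (Finset.mem_sdiff.1 hv).2]
    · rw [if_pos hv]

open scoped Classical in
theorem goodLab_block {V ι A : Type} [AddCommGroup A] (b : V → ι) (S : Finset V) (F : Finset A)
    (i : ι) (hb : ∀ v ∈ S, b v = i) (hc : S.card = F.card) (hF : ∑ x ∈ F, x = 0) :
    ∃ e, GoodLab b S F e := by
  let q := Finset.equivOfCardEq hc
  let e : V → A := fun v => if h : v ∈ S then (q ⟨v, h⟩ : A) else 0
  have he : ∀ (v) (h : v ∈ S), e v = q ⟨v, h⟩ := fun v h => by simp [e, h]
  refine ⟨e, ?_, ?_, ?_⟩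
  · intro v hv
    rw [he v hv]
    exact (q ⟨v, hv⟩).2
  · intro u hu v hv huv
    rw [he u hu, he v hv] at huv
    have := q.injective (Subtype.ext huv)
    exact congrArg Subtype.val this
  · intro j
    by_cases hj : j = i
    · subst hj
      rw [Finset.filter_true_of_mem hb, ← Finset.sum_coe_sort, ← hF, ← Finset.sum_coe_sort F]
      refine Fintype.sum_equiv q _ _ fun x => ?_
      rw [he x.1 x.2]
    · rw [Finset.filter_false_of_mem, Finset.sum_empty]
      intro v hv h
      exact hj (h.symm.trans (hb v hv))

open scoped Classical in
theorem fiber_sdiff {V ι : Type} (b : V → ι) (D S : Finset V) (i j : ι) (hS : S ⊆ D)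
    (hb : ∀ v ∈ S, b v = i) :
    ((D \ S).filter (fun v => b v = j)).card + (if j = i then S.card else 0)
      = (D.filter (fun v => b v = j)).card := by
  have h1 : (D.filter (fun v => b v = j)).card =
      ((D \ S).filter (fun v => b v = j)).card + (S.filter (fun v => b v = j)).card := by
    rw [← Finset.card_union_of_disjoint, ← Finset.filter_union, Finset.sdiff_union_of_subset hS]
    exact Finset.disjoint_filter_filter Finset.sdiff_disjoint
  rw [h1]
  congr 1
  split_ifs with h
  · subst h
    rw [Finset.filter_true_of_mem hb]
  · rw [Finset.filter_false_of_mem, Finset.card_empty]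
    intro v hv h'
    exact h (h'.symm.trans (hb v hv))

open scoped Classical in
theorem goodLab_even {V ι A : Type} [AddCommGroup A] (b : V → ι) (n : ℕ) :
    ∀ (D : Finset V) (R : Finset A), D.card = n → (∀ x ∈ R, -x ∈ R) → (∀ x ∈ R, x ≠ -x) →
      (∀ i, Even (D.filter (fun v => b v = i)).card) → D.card ≤ R.card →
      ∃ w, GoodLab b D R w := by
  induction n using Nat.strong_induction_on with
  | _ n ih =>
  intro D R hn hR hR' hD hc
  rcases D.eq_empty_or_nonempty with rfl | ⟨v, hv⟩
  · exact ⟨fun _ => 0, by simp [GoodLab]⟩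
  · have hpos : 0 < (D.filter (fun u => b u = b v)).card :=
      Finset.card_pos.2 ⟨v, by simp [hv]⟩
    have h2 : 2 ≤ (D.filter (fun u => b u = b v)).card := by
      obtain ⟨r, hr⟩ := hD (b v)
      omega
    obtain ⟨S, hS, hSc⟩ := Finset.exists_subset_card_eq h2
    have hSD : S ⊆ D := hS.trans (Finset.filter_subset _ _)
    have hSb : ∀ u ∈ S, b u = b v := fun u hu => (Finset.mem_filter.1 (hS hu)).2
    have hDpos : 0 < D.card := Finset.card_pos.2 ⟨v, hv⟩
    obtain ⟨r, hr⟩ : R.Nonempty := Finset.card_pos.1 (by omega)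
    have hrr := hR' r hr
    have hF : ({r, -r} : Finset A) ⊆ R := by
      intro x hx
      rcases Finset.mem_insert.1 hx with rfl | hx
      · exact hr
      · rw [Finset.mem_singleton.1 hx]; exact hR r hr
    have hFc : ({r, -r} : Finset A).card = 2 := Finset.card_pair hrr
    obtain ⟨e, he⟩ := goodLab_block b S {r, -r} (b v) hSb (by rw [hSc, hFc])
      (by rw [Finset.sum_pair hrr]; simp)
    have hc1 := Finset.card_sdiff_add_card_eq_card hSD
    have hc2 := Finset.card_sdiff_add_card_eq_card hF
    obtain ⟨w, hw⟩ := ih (D \ S).card (by omega) (D \ S) (R \ {r, -r}) rfl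
      (by
        intro x hx
        simp only [Finset.mem_sdiff, Finset.mem_insert, Finset.mem_singleton, not_or] at hx ⊢
        refine ⟨hR x hx.1, fun h => hx.2.2 (by rw [← h, neg_neg]), fun h => hx.2.1 (neg_injective h)⟩)
      (fun x hx => hR' x (Finset.mem_sdiff.1 hx).1)
      (by
        intro i
        have h := fiber_sdiff b D S (b v) i hSD hSb
        have h' := hD i
        rw [← h] at h'
        split_ifs at h'
        · rw [hSc] at h'
          simpa [Nat.even_add] using h'
        · simpa using h')
      (by omega)
    exact ⟨_, he.glue hSD hF hw⟩

open scoped Classical in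
/-- The blocks of odd size. -/
noncomputable def oddBlocks {V ι : Type} [Fintype ι] (b : V → ι) (D : Finset V) : Finset ι :=
  Finset.univ.filter fun i => Odd (D.filter (fun v => b v = i)).card

open scoped Classical in
theorem oddBlocks_sdiff {V ι : Type} [Fintype ι] (b : V → ι) (D S : Finset V) (i : ι)
    (hi : i ∈ oddBlocks b D) (hS : S ⊆ D) (hb : ∀ v ∈ S, b v = i) (hc : Odd S.card) :
    oddBlocks b (D \ S) = (oddBlocks b D).erase i := by
  ext j
  have h := fiber_sdiff b D S i j hS hb
  simp only [oddBlocks, Finset.mem_filter, Finset.mem_univ, true_and, Finset.mem_erase] at hi ⊢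
  by_cases hj : j = i
  · subst hj
    rw [if_pos rfl] at h
    rw [← h, Nat.odd_add] at hi
    simp only [ne_eq, not_true, false_and, iff_false]
    intro hcon
    exact Nat.not_even_iff_odd.2 hc (hi.1 hcon)
  · rw [if_neg hj, add_zero] at h
    simp [hj, h]

open scoped Classical in
theorem goodLab_six {V ι A κ : Type} [AddCommGroup A] [Fintype ι] (b : V → ι) 
    (g : κ → Fin 3 → A) (hg : SixSys g) (m : ℕ) :
    ∀ (D : Finset V) (R : Finset A) (s : Finset κ), s.card = m → (∀ x ∈ R, -x ∈ R) →
      (∀ x ∈ R, x ≠ -x) → (∀ i ∈ s, ∀ j, g i j ∈ R) →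
      (oddBlocks b D).card = 2 * m →
      (∀ i, (D.filter (fun v => b v = i)).card ≠ 1) → D.card ≤ R.card →
      ∃ w, GoodLab b D R w := by
  induction m with
  | zero =>
    intro D R s _ hR hR' _ hO _ hc
    refine goodLab_even b _ D R rfl hR hR' ?_ hc
    intro i
    rw [mul_zero, Finset.card_eq_zero] at hO
    rw [← Nat.not_odd_iff_even]
    intro h
    have : i ∈ oddBlocks b D := by simpa [oddBlocks] using h
    rw [hO] at this
    simp at this
  | succ m ih =>
    intro D R s hs hR hR' hgR hO h1 hc
    obtain ⟨k, hk⟩ : s.Nonempty := Finset.card_pos.1 (by omega)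
    obtain ⟨i1, hi1, i2, hi2, h12⟩ := Finset.one_lt_card.1 (show 1 < (oddBlocks b D).card by omega)
    have h3 : ∀ i ∈ oddBlocks b D, 3 ≤ (D.filter (fun v => b v = i)).card := by
      intro i hi
      simp only [oddBlocks, Finset.mem_filter, Finset.mem_univ, true_and] at hi
      have := h1 i
      obtain ⟨r, hr⟩ := hi
      omega
    obtain ⟨S, hS, hSc⟩ := Finset.exists_subset_card_eq (h3 i1 hi1)
    obtain ⟨T, hT, hTc⟩ := Finset.exists_subset_card_eq (h3 i2 hi2)
    have hSD : S ⊆ D := hS.trans (Finset.filter_subset _ _)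
    have hSb : ∀ u ∈ S, b u = i1 := fun u hu => (Finset.mem_filter.1 (hS hu)).2
    have hTb : ∀ u ∈ T, b u = i2 := fun u hu => (Finset.mem_filter.1 (hT hu)).2
    have hTD : T ⊆ D \ S := by
      intro u hu
      refine Finset.mem_sdiff.2 ⟨(Finset.mem_filter.1 (hT hu)).1, fun h => h12 ?_⟩
      rw [← hSb u h, hTb u hu]
    let F : Finset A := Finset.univ.image (g k)
    let F' : Finset A := Finset.univ.image (fun j => - g k j)
    have inj : Function.Injective (g k) := fun j j' h => (hg.2.1 _ _ _ _ h).2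
    have inj' : Function.Injective (fun j => - g k j) := fun j j' h => inj (neg_injective h)
    have hFc : F.card = 3 := by rw [Finset.card_image_of_injective _ inj]; simp
    have hFc' : F'.card = 3 := by rw [Finset.card_image_of_injective _ inj']; simp
    have hFs : ∑ x ∈ F, x = 0 := by
      rw [Finset.sum_image (fun x _ y _ h => inj h), Fin.sum_univ_three, hg.1]
    have hFs' : ∑ x ∈ F', x = 0 := by
      rw [Finset.sum_image (fun x _ y _ h => inj' h), Finset.sum_neg_distrib, Fin.sum_univ_three,
        hg.1, neg_zero]
    have hFR : F ⊆ R := by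
      intro x hx
      obtain ⟨j, _, rfl⟩ := Finset.mem_image.1 hx
      exact hgR k hk j
    have hFR' : F' ⊆ R \ F := by
      intro x hx
      obtain ⟨j, _, rfl⟩ := Finset.mem_image.1 hx
      refine Finset.mem_sdiff.2 ⟨hR _ (hgR k hk j), fun h => ?_⟩
      obtain ⟨j', _, hj'⟩ := Finset.mem_image.1 h
      exact hg.2.2 _ _ _ _ hj'
    obtain ⟨e, he⟩ := goodLab_block b S F i1 hSb (by rw [hSc, hFc]) hFs
    obtain ⟨e', he'⟩ := goodLab_block b T F' i2 hTb (by rw [hTc, hFc']) hFs'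
    have o1 := oddBlocks_sdiff b D S i1 hi1 hSD hSb (by rw [hSc]; decide)
    have hi2' : i2 ∈ oddBlocks b (D \ S) := by
      rw [o1]; exact Finset.mem_erase.2 ⟨h12.symm, hi2⟩
    have o2 := oddBlocks_sdiff b (D \ S) T i2 hi2' hTD hTb (by rw [hTc]; decide)
    have hc1 := Finset.card_sdiff_add_card_eq_card hSD
    have hc2 := Finset.card_sdiff_add_card_eq_card hTD
    have hc3 := Finset.card_sdiff_add_card_eq_card hFR
    have hc4 := Finset.card_sdiff_add_card_eq_card hFR'
    obtain ⟨w, hw⟩ := ih ((D \ S) \ T) ((R \ F) \ F') (s.erase k)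
      (by rw [Finset.card_erase_of_mem hk, hs]; rfl)
      (by
        intro x hx
        simp only [Finset.mem_sdiff, F, F', Finset.mem_image, Finset.mem_univ, true_and,
          not_exists] at hx ⊢
        refine ⟨⟨hR x hx.1.1, fun j h => hx.2 j (by rw [h, neg_neg])⟩,
          fun j h => hx.1.2 j (neg_injective h)⟩)
      (fun x hx => hR' x (Finset.mem_sdiff.1 (Finset.mem_sdiff.1 hx).1).1)
      (by
        intro i hi j
        obtain ⟨hik, his⟩ := Finset.mem_erase.1 hi
        simp only [Finset.mem_sdiff, F, F', Finset.mem_image, Finset.mem_univ, true_and,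
          not_exists]
        refine ⟨⟨hgR i his j, fun j' h => hik (hg.2.1 _ _ _ _ h).1.symm⟩,
          fun j' h => hg.2.2 _ _ _ _ h.symm⟩)
      (by
        rw [o2, Finset.card_erase_of_mem hi2', o1, Finset.card_erase_of_mem hi1]
        omega)
      (by
        intro i
        have f1 := fiber_sdiff b D S i1 i hSD hSb
        have f2 := fiber_sdiff b (D \ S) T i2 i hTD hTb
        have f3 := h1 i
        by_cases e1 : i = i1
        · have e2 : i ≠ i2 := fun h => h12 (e1.symm.trans h)
          rw [if_pos e1] at f1
          rw [if_neg e2] at f2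
          subst e1
          have := h3 i hi1
          simp only [oddBlocks, Finset.mem_filter, Finset.mem_univ, true_and] at hi1
          obtain ⟨r, hr⟩ := hi1
          omega
        · rw [if_neg e1] at f1
          by_cases e2 : i = i2
          · rw [if_pos e2] at f2
            subst e2
            have := h3 i hi2
            simp only [oddBlocks, Finset.mem_filter, Finset.mem_univ, true_and] at hi2
            obtain ⟨r, hr⟩ := hi2
            omega
          · rw [if_neg e2] at f2
            omega)
      (by omega)
    exact ⟨_, he.glue hSD hFR (he'.glue hTD hFR' hw)⟩

open scoped Classical in
theorem zero_sum_labeling {V ι A : Type} [Fintype V] [Fintype ι] [AddCommGroup A] [Fintype A]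
    (hA : Odd (Fintype.card A)) (hVA : Fintype.card V ≤ Fintype.card A) (b : V → ι)
    (hb : ∀ i, (Finset.univ.filter (fun v => b v = i)).card ≠ 1) :
    ∃ w : V → A, Function.Injective w ∧ ∀ i, ∑ v with b v = i, w v = 0 := by
  suffices h : ∃ w, GoodLab b (Finset.univ : Finset V) (Finset.univ : Finset A) w by
    obtain ⟨w, hw⟩ := h
    exact ⟨w, fun x y h => hw.2.1 (by simp) (by simp) h, hw.2.2⟩
  set R : Finset A := Finset.univ \ {0} with hR
  have hRc : R.card + 1 = Fintype.card A := by
    have := Finset.card_sdiff_add_card_eq_card (Finset.subset_univ ({0} : Finset A))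
    simpa using this
  have hR1 : ∀ x ∈ R, -x ∈ R := by simp [R]
  have hR2 : ∀ x ∈ R, x ≠ -x := by
    intro x hx h
    have h0 : x ≠ 0 := by simpa [R] using hx
    exact h0 (odd_two_inj hA x (by nth_rewrite 1 [h]; simp))
  have hsum : Fintype.card V = ∑ i, (Finset.univ.filter (fun v => b v = i)).card := by
    rw [← Finset.card_univ]
    exact Finset.card_eq_sum_card_fiberwise (by simp)
  have hpar : Odd (Fintype.card V) ↔ Odd (oddBlocks b (Finset.univ : Finset V)).card := by
    rw [hsum]
    exact Finset.odd_sum_iff_odd_card_odd _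
  have h3 : 3 * (oddBlocks b (Finset.univ : Finset V)).card ≤ Fintype.card V := by
    rw [hsum]
    refine le_trans ?_ (Finset.sum_le_sum_of_subset (Finset.subset_univ
      (oddBlocks b (Finset.univ : Finset V))))
    rw [mul_comm, ← smul_eq_mul]
    refine Finset.card_nsmul_le_sum _ _ _ fun i hi => ?_
    simp only [oddBlocks, Finset.mem_filter, Finset.mem_univ, true_and] at hi
    have := hb i
    obtain ⟨r, hr⟩ := hi
    omega
  have six : ∀ m, 6 * m + 1 ≤ Fintype.card A → ∀ D : Finset V,
      (oddBlocks b D).card = 2 * m → (∀ i, (D.filter (fun v => b v = i)).card ≠ 1) →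
      D.card ≤ R.card → ∃ w, GoodLab b D R w := by
    intro m hm D hO h1 hc
    obtain ⟨g, hg⟩ := sixsys_exists _ A rfl hA m hm
    refine goodLab_six b g hg m D R Finset.univ (by simp) hR1 hR2 ?_ hO h1 hc
    intro i _ j
    have : g i j ≠ 0 := fun h => hg.2.2 i j i j (by rw [h, neg_zero])
    simpa [R] using this
  obtain ⟨a, ha⟩ := hA
  rcases Nat.even_or_odd (oddBlocks b (Finset.univ : Finset V)).card with ho | ho
  · have hV : ¬ Odd (Fintype.card V) := by rwa [hpar, Nat.not_odd_iff_even]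
    obtain ⟨c, hc⟩ := Nat.not_odd_iff_even.1 hV
    obtain ⟨m, hm⟩ := ho
    obtain ⟨w, hw⟩ := six m (by omega) Finset.univ (by omega) hb (by rw [Finset.card_univ]; omega)
    exact ⟨w, fun _ _ => Finset.mem_univ _, hw.2⟩
  · obtain ⟨m, hm⟩ := ho
    obtain ⟨i, hi⟩ := Finset.card_pos.1 (show 0 < (oddBlocks b (Finset.univ : Finset V)).card by omega)
    have hi' := hi
    simp only [oddBlocks, Finset.mem_filter, Finset.mem_univ, true_and] at hi'
    obtain ⟨v, hv⟩ := Finset.card_pos.1 hi'.pos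
    have hvb : ∀ u ∈ ({v} : Finset V), b u = i := by
      intro u hu
      rw [Finset.mem_singleton.1 hu]
      exact (Finset.mem_filter.1 hv).2
    have o1 := oddBlocks_sdiff b Finset.univ {v} i hi (Finset.subset_univ _) hvb (by simp)
    have hc1 := Finset.card_sdiff_add_card_eq_card (Finset.subset_univ ({v} : Finset V))
    rw [Finset.card_univ, Finset.card_singleton] at hc1
    obtain ⟨e, he⟩ := goodLab_block b {v} ({0} : Finset A) i hvb (by simp) (by simp)
    obtain ⟨w, hw⟩ := six m (by omega) (Finset.univ \ {v})
      (by rw [o1, Finset.card_erase_of_mem hi]; omega)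
      (by
        intro j
        have f1 := fiber_sdiff b Finset.univ {v} i j (Finset.subset_univ _) hvb
        have f2 := hb j
        rw [Finset.card_singleton] at f1
        split_ifs at f1 with hj
        · subst hj
          obtain ⟨r, hr⟩ := hi'
          omega
        · omega)
      (by omega)
    exact ⟨_, he.glue (Finset.subset_univ _) (Finset.subset_univ _) hw⟩

end Partition


section GraphPart

/-- The weighted degree map as a homomorphism. -/
noncomputable def wdegHom {V : Type} [Fintype V] (G : SimpleGraph V) (A : Type) [AddCommGroup A] :
    (Sym2 V → A) →+ (V → A) where
  toFun f := G.wdeg f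
  map_zero' := by
    funext v
    simp [SimpleGraph.wdeg]
  map_add' f g := by
    funext v
    simp [SimpleGraph.wdeg, Finset.sum_add_distrib]

open scoped Classical in
theorem edge_mem {V : Type} [Fintype V] (G : SimpleGraph V) (A : Type) [AddCommGroup A]
    (u v : V) (h : G.Adj u v) (x : A) :
    (Pi.single u x + Pi.single v x : V → A) ∈ (wdegHom G A).range := by
  have huv : u ≠ v := h.ne
  refine ⟨Pi.single s(u, v) x, ?_⟩
  funext y
  change ∑ z ∈ (G.neighborSet y).toFinite.toFinset, (Pi.single s(u, v) x : Sym2 V → A) s(y, z) = _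
  by_cases hu : y = u
  · subst hu
    rw [Finset.sum_eq_single v]
    · simp [huv]
    · intro z _ hz
      rw [Pi.single_eq_of_ne]
      intro h'
      exact hz (Sym2.congr_right.1 h')
    · intro h'
      simp [h] at h'
  · by_cases hv : y = v
    · subst hv
      rw [Finset.sum_eq_single u]
      · rw [Sym2.eq_swap]
        simp [hu]
      · intro z _ hz
        rw [Pi.single_eq_of_ne]
        intro h'
        rw [Sym2.eq_swap (a := u)] at h'
        exact hz (Sym2.congr_right.1 h')
      · intro h'
        simp [h.symm] at h'
    · rw [Finset.sum_eq_zero]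
      · simp [hu, hv]
      · intro z _
        rw [Pi.single_eq_of_ne]
        intro h'
        rcases Sym2.eq_iff.1 h' with ⟨h1, _⟩ | ⟨h1, _⟩
        · exact hu h1
        · exact hv h1

open scoped Classical in
/-- Two vertices are equivalent if weight can be moved from one to the other. -/
def moveSetoid {V : Type} [Fintype V] (G : SimpleGraph V) (A : Type) [AddCommGroup A] :
    Setoid V where
  r u v := ∀ x : A, (Pi.single u x - Pi.single v x : V → A) ∈ (wdegHom G A).range
  iseqv :=
    { refl := fun u x => by rw [sub_self]; exact zero_mem _
      symm := fun {u v} h x => by rw [← neg_sub]; exact neg_mem (h x)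
      trans := fun {u v z} h h' x => by
        rw [← sub_add_sub_cancel _ (Pi.single v x) _]; exact add_mem (h x) (h' x) }

open scoped Classical in
theorem mem_range_of_sums {V : Type} [Fintype V] (G : SimpleGraph V) (A : Type) [AddCommGroup A]
    [Fintype (Quotient (moveSetoid G A))] (w : V → A)
    (hw : ∀ i : Quotient (moveSetoid G A), ∑ v with Quotient.mk _ v = i, w v = 0) :
    w ∈ (wdegHom G A).range := by
  have h1 : w = ∑ v, (Pi.single v (w v) - Pi.single (Quotient.mk (moveSetoid G A) v).out (w v))
      + ∑ v, (Pi.single (Quotient.mk (moveSetoid G A) v).out (w v) : V → A) := by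
    rw [Finset.sum_sub_distrib, sub_add_cancel, Finset.univ_sum_single]
  have h2 : ∑ v, (Pi.single (Quotient.mk (moveSetoid G A) v).out (w v) : V → A) = 0 := by
    rw [← Finset.sum_fiberwise (s := Finset.univ) (g := fun v => Quotient.mk (moveSetoid G A) v)]
    refine Finset.sum_eq_zero fun i _ => ?_
    have : ∀ v ∈ Finset.univ.filter (fun v => Quotient.mk (moveSetoid G A) v = i),
        (Pi.single (Quotient.mk (moveSetoid G A) v).out (w v) : V → A) =
          AddMonoidHom.single (fun _ => A) i.out (w v) := by
      intro v hv
      rw [(Finset.mem_filter.1 hv).2]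
      rfl
    rw [Finset.sum_congr rfl this, ← map_sum, hw, map_zero]
  rw [h1, h2, add_zero]
  refine sum_mem fun v _ => ?_
  have : (moveSetoid G A).r v (Quotient.mk (moveSetoid G A) v).out :=
    (moveSetoid G A).symm (Quotient.exact (Quotient.out_eq _))
  exact this (w v)

theorem star_of_no_two_step {V : Type} [Fintype V] (G : SimpleGraph V) (v : V)
    (h : ∀ x y, G.Adj v x → G.Adj x y → y = v) :
    ∃ u : ℕ, Nonempty (G.induce (G.connectedComponentMk v).supp ≃g
      completeBipartiteGraph Unit (Fin u)) := by
  classical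
  have hreach : ∀ u, G.Reachable v u → u = v ∨ G.Adj v u := by
    intro u hu
    rw [SimpleGraph.reachable_iff_reflTransGen] at hu
    induction hu with
    | refl => exact Or.inl rfl
    | tail _ hxy ih =>
      rcases ih with rfl | ih
      · exact Or.inr hxy
      · exact Or.inl (h _ _ ih hxy)
  let e := Fintype.equivFin (G.neighborSet v)
  let F : Unit ⊕ Fin (Fintype.card (G.neighborSet v)) → (G.connectedComponentMk v).supp := fun x =>
    match x with
    | Sum.inl _ => ⟨v, rfl⟩
    | Sum.inr i => ⟨(e.symm i : V), by
        rw [SimpleGraph.ConnectedComponent.mem_supp_iff, SimpleGraph.ConnectedComponent.eq]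
        exact (SimpleGraph.Adj.reachable (e.symm i).2).symm⟩
  have hadj : ∀ i, G.Adj v (e.symm i : V) := fun i => (e.symm i).2
  have hF : Function.Bijective F := by
    constructor
    · rintro (⟨⟩ | i) (⟨⟩ | j) hij
      · rfl
      · exact absurd (congrArg Subtype.val hij) (hadj j).ne
      · exact absurd (congrArg Subtype.val hij) (hadj i).ne'
      · have h1 := congrArg Subtype.val hij
        have h0 : (e.symm i : V) = (e.symm j : V) := h1
        rw [e.symm.injective (Subtype.ext h0)]
    · rintro ⟨u, hu⟩
      rw [SimpleGraph.ConnectedComponent.mem_supp_iff, SimpleGraph.ConnectedComponent.eq] at hu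
      rcases hreach u hu.symm with rfl | hu'
      · exact ⟨Sum.inl (), rfl⟩
      · exact ⟨Sum.inr (e ⟨u, hu'⟩), Subtype.ext (by simp [F])⟩
  refine ⟨_, ⟨RelIso.symm ⟨Equiv.ofBijective F hF, ?_⟩⟩⟩
  rintro (⟨⟩ | i) (⟨⟩ | j)
  · simp [F, completeBipartiteGraph]
  · simpa [F, completeBipartiteGraph] using hadj j
  · simpa [F, completeBipartiteGraph] using (hadj i).symm
  · simp only [Equiv.ofBijective_apply, SimpleGraph.comap_adj, F, completeBipartiteGraph]
    simp
    intro hij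
    exact (hadj j).ne' (h _ _ (hadj i) hij)

end GraphPart

/-- Let `G` be a finite simple graph of order `n` having no connected component
isomorphic to a star `K_{1,u}` for any integer `u ≥ 0`. Then for every odd integer
`t ≥ n` and every Abelian group of order `t`, there exists an irregular labeling. -/
theorem exists_irregular_labeling_of_no_star_component
    {V : Type} [Fintype V] (G : SimpleGraph V) (n : ℕ) (hn : Fintype.card V = n)
    (hstar : ∀ (c : G.ConnectedComponent) (u : ℕ),
      ¬ Nonempty (G.induce c.supp ≃g completeBipartiteGraph Unit (Fin u))) :
    ∀ t : ℕ, Odd t → n ≤ t →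
      ∀ (A : Type) [AddCommGroup A] [Fintype A], Fintype.card A = t →
        ∃ f : Sym2 V → A, G.IsIrregular f := by
  classical
  intro t ht hnt A _ _ hA
  have : Fintype (Quotient (moveSetoid G A)) := Fintype.ofFinite _
  obtain ⟨w, hw, hws⟩ := zero_sum_labeling (A := A) (by rwa [hA]) (by rw [hn, hA]; exact hnt)
    (fun v => Quotient.mk (moveSetoid G A) v) (by
      intro i hi
      obtain ⟨v, hv⟩ := Finset.card_eq_one.1 hi
      have hmem : ∀ y, Quotient.mk (moveSetoid G A) y = i ↔ y = v := by
        intro y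
        have := Finset.ext_iff.1 hv y
        simpa using this
      have hvi : Quotient.mk (moveSetoid G A) v = i := (hmem v).2 rfl
      obtain ⟨u, hu⟩ := star_of_no_two_step G v (by
        intro x y hx hy
        have hr : (moveSetoid G A).r y v := by
          intro z
          have h1 := edge_mem G A x y hy z
          have h2 := edge_mem G A v x hx z
          have h3 := sub_mem h1 h2
          convert h3 using 1
          abel
        exact (hmem y).1 ((Quotient.sound hr).trans hvi))
      exact hstar _ u hu)
  obtain ⟨f, hf⟩ := mem_range_of_sums G A w (by
    intro i
    convert hws i)
  refine ⟨f, ?_⟩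
  have : G.wdeg f = w := hf
  rw [SimpleGraph.IsIrregular, this]
  exact hw
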